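/- Let B be an Erdős set and let (X_η, S) be the associated B-free subshift. If a cellular automaton τ on (X_η, S) is surjective, then τ = S^t for some t ∈ ℤ. -/

import Mathlib

open Filter Set

noncomputable section

/-- The shift by `t`: `(shiftPow t x) n = x (n + t)`, i.e. `S^t`. -/
def shiftPow (t : ℤ) (x : ℤ → Bool) : ℤ → Bool := fun n => x (n + t)

/-- The left shift `S`, `(S x) n = x (n + 1)`. -/
def shift : (ℤ → Bool) → (ℤ → Bool) := shiftPow 1

/-- The support of a `0-1`-sequence. -/
def supp (x : ℤ → Bool) : Set ℤ := {n | x n = true}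

/-- The all-zero sequence `0^ℤ`. -/
def zeroSeq : ℤ → Bool := fun _ => false

/-- The all-one sequence `1^ℤ`. -/
def oneSeq : ℤ → Bool := fun _ => true

/-- The sequence `u = 0^{-ℕ} 1 0^{ℕ}` with a single `1` at position `0`. -/
def uSeq : ℤ → Bool := fun n => if n = 0 then true else false

/-- The set `F_B ⊆ ℤ` of `B`-free integers. -/
def BFreeSet (B : Set ℕ) : Set ℤ := {n | ∀ b ∈ B, ¬ ((b : ℤ) ∣ n)}

open Classical in
/-- `η`, the indicator function of the `B`-free integers. -/
noncomputable def eta (B : Set ℕ) : ℤ → Bool := fun n => if n ∈ BFreeSet B then true else false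

/-- The `B`-free subshift `X_η`: the orbit closure of `η` under the shift. -/
def Xeta (B : Set ℕ) : Set (ℤ → Bool) := closure {x | ∃ t : ℤ, x = shiftPow t (eta B)}

/-- A set `A ⊆ ℤ` is `B`-admissible if for every `b ∈ B` some residue class
mod `b` is disjoint from `A`. -/
def IsBAdmissible (B : Set ℕ) (A : Set ℤ) : Prop :=
  ∀ b ∈ B, ∃ r : ℤ, ∀ a ∈ A, ¬ ((b : ℤ) ∣ (a - r))

/-- The `B`-admissible subshift `X_B`. -/
def XB (B : Set ℕ) : Set (ℤ → Bool) := {x | IsBAdmissible B (supp x)}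

/-- `B` is primitive: no element divides a different element. -/
def Primitive (B : Set ℕ) : Prop := ∀ a ∈ B, ∀ b ∈ B, a ∣ b → a = b

/-- `B` is an Erdős set: infinite, `1 ∉ B` (elements positive), primitive, pairwise
coprime and thin. -/
def IsErdos (B : Set ℕ) : Prop :=
  B.Infinite ∧ (∀ b ∈ B, 2 ≤ b) ∧ Primitive B ∧
    (∀ a ∈ B, ∀ b ∈ B, a ≠ b → Nat.Coprime a b) ∧
    Summable (fun b : B => (1 : ℝ) / (b : ℝ))

/-- A cellular automaton on `X`: a continuous self-map of `X` commuting with the shift. -/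
def IsCA (X : Set (ℤ → Bool)) (τ : (ℤ → Bool) → (ℤ → Bool)) : Prop :=
  Set.MapsTo τ X X ∧ ContinuousOn τ X ∧ ∀ x ∈ X, τ (shift x) = shift (τ x)

/-- Pre-injectivity of a CA on `X`. -/
def PreInjective (X : Set (ℤ → Bool)) (τ : (ℤ → Bool) → (ℤ → Bool)) : Prop :=
  ∀ x ∈ X, ∀ y ∈ X, τ x = τ y → {n : ℤ | x n ≠ y n}.Finite → x = y

/-- `X` is hereditary. -/
def Hereditary (X : Set (ℤ → Bool)) : Prop :=
  ∀ x ∈ X, ∀ y : ℤ → Bool, (∀ n, y n ≤ x n) → y ∈ X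

/-- The hereditary closure `X̃` of a set `X`. -/
def heredClosure (X : Set (ℤ → Bool)) : Set (ℤ → Bool) :=
  {y | ∃ x ∈ X, ∀ n, y n ≤ x n}

/-- `X` is a subshift: nonempty, closed and shift-invariant. -/
def IsSubshift (X : Set (ℤ → Bool)) : Prop :=
  X.Nonempty ∧ IsClosed X ∧ shift '' X = X

/-- `τ` is given by a (sliding block) code of radius `ℓ` on `X`. -/
def HasRadius (X : Set (ℤ → Bool)) (τ : (ℤ → Bool) → (ℤ → Bool)) (ℓ : ℕ) : Prop :=
  ∀ x ∈ X, ∀ y ∈ X, ∀ n : ℤ,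
    (∀ i : ℤ, n - ℓ ≤ i → i ≤ n + ℓ → x i = y i) → τ x n = τ y n

open Classical in
/-- `A ⊆ ℤ` has logarithmic density `d`. -/
noncomputable def HasLogDensity (A : Set ℤ) (d : ℝ) : Prop :=
  Tendsto (fun N : ℕ =>
      (Real.log N)⁻¹ * ∑ n ∈ Finset.Icc 1 N, (if (n : ℤ) ∈ A then (1 : ℝ) / (n : ℝ) else 0))
    atTop (nhds d)

/-- `B` is taut: removing any `b ∈ B` strictly increases the logarithmic density of the
`B`-free integers. -/
def IsTaut (B : Set ℕ) : Prop :=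
  ∀ b ∈ B, ∀ d d' : ℝ,
    HasLogDensity (BFreeSet B) d → HasLogDensity (BFreeSet (B \ {b})) d' → d < d'

/-- `x` and `y` are proximal: along some sequence `r k → ∞`, the shifted sequences
`S^{r k} x` and `S^{r k} y` agree on arbitrarily large central windows, i.e.
`d(S^{r k} x, S^{r k} y) → 0` in the product topology. -/
def ProximalPair (x y : ℤ → Bool) : Prop :=
  ∃ r : ℕ → ℤ, Tendsto r atTop atTop ∧
    ∀ m : ℕ, ∀ᶠ k in atTop, ∀ n : ℤ, |n| ≤ (m : ℤ) →
      shiftPow (r k) x n = shiftPow (r k) y n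

/-- A subshift is proximal if every pair of its points is proximal. -/
def IsProximalSubshift (X : Set (ℤ → Bool)) : Prop :=
  ∀ x ∈ X, ∀ y ∈ X, ProximalPair x y

end

section Arithmetic

lemma exists_modEq_iff_dvd_add_mul {b Q : ℕ} (hb : 0 < b) (hQ : Nat.Coprime Q b) (a : ℤ) :
    ∃ v : ℕ, ∀ k : ℕ, (b : ℤ) ∣ a + Q * k ↔ k ≡ v [MOD b] := by
  obtain ⟨u, w, huw⟩ := Nat.isCoprime_iff_coprime.mpr hQ
  have hb' : (b : ℤ) ≠ 0 := by positivity
  refine ⟨((-a * u) % b).toNat, fun k => ?_⟩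
  have hv : (((-a * u) % b).toNat : ℤ) = (-a * u) % b := Int.toNat_of_nonneg (Int.emod_nonneg _ hb')
  rw [← Int.natCast_modEq_iff, hv]
  have h1 : (-a * u) % (b : ℤ) ≡ -a * u [ZMOD b] := Int.mod_modEq _ _
  constructor
  · intro h
    refine Int.ModEq.trans ?_ h1.symm
    refine (Int.modEq_iff_dvd.mpr ?_).symm
    have : (k : ℤ) - -a * u = u * (a + Q * k) + w * k * b := by linear_combination -(k : ℤ) * huw
    rw [this]
    exact dvd_add (h.mul_left _) (Dvd.intro_left _ rfl)
  · intro h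
    obtain ⟨c, hc⟩ := Int.modEq_iff_dvd.mp (h.trans h1)
    refine ⟨a * w - Q * c, ?_⟩
    linear_combination (-a) * huw - Q * hc

lemma card_filter_dvd_add_mul_le {b Q : ℕ} (hb : 0 < b) (hQ : Nat.Coprime Q b) (a : ℤ) (M : ℕ) :
    (((Finset.range M).filter (fun k : ℕ => (b : ℤ) ∣ a + Q * k)).card : ℝ) ≤ M * (1 / b) + 1 := by
  obtain ⟨v, hv⟩ := exists_modEq_iff_dvd_add_mul hb hQ a
  simp only [hv]
  rw [← Nat.count_eq_card_filter_range, Nat.count_modEq_card _ hb]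
  have h : ((M / b : ℕ) : ℝ) ≤ M / b := Nat.cast_div_le
  rw [mul_one_div]
  push_cast
  split_ifs <;> simp <;> linarith

lemma card_filter_dvd_add_mul_of_dvd {b Q : ℕ} (hb : 0 < b) (hQ : Nat.Coprime Q b) (a : ℤ) {M : ℕ}
    (hM : b ∣ M) :
    (((Finset.range M).filter (fun k : ℕ => (b : ℤ) ∣ a + Q * k)).card : ℝ) = M * (1 / b) := by
  obtain ⟨v, hv⟩ := exists_modEq_iff_dvd_add_mul hb hQ a
  simp only [hv]
  rw [← Nat.count_eq_card_filter_range, Nat.count_modEq_card _ hb, Nat.mod_eq_zero_of_dvd hM,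
    mul_one_div]
  simp [Nat.cast_div_charZero hM]

lemma exists_int_dvd_sub (S : Finset ℕ) (hpos : ∀ b ∈ S, 0 < b)
    (hcop : ∀ a ∈ S, ∀ b ∈ S, a ≠ b → Nat.Coprime a b) (r : ℕ → ℤ) :
    ∃ t : ℤ, ∀ b ∈ S, (b : ℤ) ∣ t - r b := by
  obtain ⟨k, hk⟩ := Nat.chineseRemainderOfFinset (fun b => (r b % (b : ℤ)).toNat) id S
    (fun b hb => (hpos b hb).ne') (fun a ha b hb hab => hcop a ha b hb hab)
  refine ⟨k, fun b hb => ?_⟩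
  have h := Int.natCast_modEq_iff.mpr (hk b hb)
  have hb' : (b : ℤ) ≠ 0 := by exact_mod_cast (hpos b hb).ne'
  rw [Int.toNat_of_nonneg (Int.emod_nonneg _ hb')] at h
  exact Int.modEq_iff_dvd.mp (h.trans (Int.mod_modEq _ _)).symm

/-- Fewer than `b` integers cannot meet every residue class mod `b`. -/
lemma exists_residue_avoided (E : Finset ℤ) {b : ℕ} (h : E.card < b) :
    ∃ r : ℤ, ∀ a ∈ E, ¬ (b : ℤ) ∣ a - r := by
  have hb : (0 : ℤ) < b := by exact_mod_cast (Nat.zero_le _).trans_lt h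
  have hc : (E.image (fun a => a % (b : ℤ))).card < (Finset.Ico (0 : ℤ) b).card := by
    refine Finset.card_image_le.trans_lt ?_
    simpa using h
  obtain ⟨r, hr, hr'⟩ := Finset.exists_mem_notMem_of_card_lt_card hc
  refine ⟨r, fun a ha hd => hr' ?_⟩
  rw [Finset.mem_image]
  refine ⟨a, ha, ?_⟩
  rw [Finset.mem_Ico] at hr
  rw [← Int.emod_eq_of_lt hr.1 hr.2]
  exact (Int.modEq_iff_dvd.mpr hd).symm

/-- Some residue class mod `b` contains at most the fraction `1 / b` of a finite set. -/
lemma exists_residue_card_le (E : Finset ℤ) {b : ℕ} (hb : 0 < b) :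
    ∃ r : ℤ, ((E.filter (fun a => (b : ℤ) ∣ a - r)).card : ℝ) ≤ E.card * (1 / b) := by
  have hb' : (0 : ℤ) < b := by exact_mod_cast hb
  obtain ⟨r, hr, h⟩ := Finset.exists_card_fiber_le_of_card_le_nsmul (s := E)
    (t := Finset.Ico (0 : ℤ) b) (f := fun a => a % (b : ℤ)) (b := (E.card : ℝ) * (1 / b))
    ⟨0, by simpa using hb⟩ (by
      have : (b : ℝ) ≠ 0 := by positivity
      simp; field_simp; rfl)
  refine ⟨r, le_trans ?_ h⟩
  rw [Finset.mem_Ico] at hr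
  gcongr with a ha
  intro hd
  rw [← Int.emod_eq_of_lt hr.1 hr.2]
  exact (Int.modEq_iff_dvd.mpr hd).symm

/-- A finite set can be thinned out so as to miss a residue class for each modulus in `T`. -/
lemma exists_subset_avoiding (E : Finset ℤ) (T : Finset ℕ) (hT : ∀ b ∈ T, 0 < b) :
    ∃ A ⊆ E, (E.card : ℝ) * (1 - ∑ b ∈ T, (1 : ℝ) / b) ≤ A.card ∧
      ∀ b ∈ T, ∃ r : ℤ, ∀ a ∈ A, ¬ (b : ℤ) ∣ a - r := by
  have hr : ∀ b : ℕ, ∃ r : ℤ, b ∈ T →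
      ((E.filter (fun a => (b : ℤ) ∣ a - r)).card : ℝ) ≤ E.card * (1 / b) := by
    intro b
    by_cases hb : b ∈ T
    · obtain ⟨r, hr⟩ := exists_residue_card_le E (hT b hb)
      exact ⟨r, fun _ => hr⟩
    · exact ⟨0, fun h => absurd h hb⟩
  choose r hr using hr
  set D := T.biUnion (fun b => E.filter (fun a => (b : ℤ) ∣ a - r b)) with hD
  refine ⟨E \ D, Finset.sdiff_subset, ?_, fun b hb => ⟨r b, fun a ha hd => ?_⟩⟩
  · have h1 : (D.card : ℝ) ≤ E.card * ∑ b ∈ T, (1 : ℝ) / b := by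
      calc (D.card : ℝ) ≤ ∑ b ∈ T, ((E.filter (fun a => (b : ℤ) ∣ a - r b)).card : ℝ) := by
            exact_mod_cast Finset.card_biUnion_le
        _ ≤ ∑ b ∈ T, (E.card : ℝ) * (1 / b) := Finset.sum_le_sum hr
        _ = _ := by rw [Finset.mul_sum]
    have h2 : (E.card : ℝ) ≤ (E \ D).card + D.card := by
      exact_mod_cast Nat.sub_le_iff_le_add.mp (Finset.le_card_sdiff D E)
    linarith
  · rw [Finset.mem_sdiff] at ha
    exact ha.2 (Finset.mem_biUnion.mpr ⟨b, hb, Finset.mem_filter.mpr ⟨ha.1, hd⟩⟩)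

end Arithmetic

section Erdos

variable {B : Set ℕ}

lemma IsErdos.pos (hB : IsErdos B) {b : ℕ} (hb : b ∈ B) : 0 < b :=
  Nat.lt_of_lt_of_le Nat.zero_lt_two (hB.2.1 b hb)

lemma IsErdos.coprime (hB : IsErdos B) {a b : ℕ} (ha : a ∈ B) (hb : b ∈ B) (h : a ≠ b) :
    Nat.Coprime a b := hB.2.2.2.1 a ha b hb h

lemma IsErdos.exists_tail_lt (hB : IsErdos B) {ε : ℝ} (hε : 0 < ε) :
    ∃ S : Finset ℕ, (S : Set ℕ) ⊆ B ∧
      ∀ T : Finset ℕ, (T : Set ℕ) ⊆ B → Disjoint T S → ∑ b ∈ T, (1 : ℝ) / b < ε := by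
  classical
  obtain ⟨s, hs⟩ := summable_iff_vanishing_norm.mp hB.2.2.2.2 ε hε
  refine ⟨s.image Subtype.val, ?_, fun T hT hd => ?_⟩
  · intro b hb
    obtain ⟨c, -, rfl⟩ := Finset.mem_image.mp (Finset.mem_coe.mp hb)
    exact c.2
  · have h := hs (T.subtype (· ∈ B)) (by
      rw [Finset.disjoint_left] at hd ⊢
      intro c hc hc'
      exact hd (Finset.mem_subtype.mp hc) (Finset.mem_image_of_mem _ hc'))
    rw [Finset.sum_subtype_of_mem (fun b : ℕ => (1 : ℝ) / b) (fun b hb => hT hb)] at h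
    exact (le_abs_self _).trans_lt h

lemma IsErdos.exists_tail_lt_of_subset (hB : IsErdos B) {ε : ℝ} (hε : 0 < ε) (F : Finset ℕ)
    (hF : (F : Set ℕ) ⊆ B) :
    ∃ S : Finset ℕ, F ⊆ S ∧ (S : Set ℕ) ⊆ B ∧
      ∀ T : Finset ℕ, (T : Set ℕ) ⊆ B → Disjoint T S → ∑ b ∈ T, (1 : ℝ) / b < ε := by
  obtain ⟨S, hS, h⟩ := hB.exists_tail_lt hε
  refine ⟨F ∪ S, Finset.subset_union_left, ?_, fun T hT hd => h T hT ?_⟩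
  · rw [Finset.coe_union]; exact Set.union_subset hF hS
  · exact hd.mono_right Finset.subset_union_right

lemma IsErdos.coprime_prod (hB : IsErdos B) {S : Finset ℕ} (hS : (S : Set ℕ) ⊆ B) {b : ℕ}
    (hb : b ∈ B) (hbS : b ∉ S) : Nat.Coprime (∏ c ∈ S, c) b :=
  Nat.Coprime.prod_left fun _ hc => hB.coprime (hS hc) hb fun h => hbS (h ▸ hc)

lemma IsErdos.prod_pos (hB : IsErdos B) {S : Finset ℕ} (hS : (S : Set ℕ) ⊆ B) :
    0 < ∏ c ∈ S, c := Finset.prod_pos fun _ hc => hB.pos (hS hc)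

/-- Sieving an arithmetic progression by the moduli outside a finite set. -/
lemma IsErdos.exists_progression_free (hB : IsErdos B) (S : Finset ℕ) (Q : ℕ)
    (hQ : ∀ b ∈ B, b ∉ S → Nat.Coprime Q b) (A : Finset ℤ) (hA : ∀ a ∈ A, 0 < a)
    (hS : ∀ T : Finset ℕ, (T : Set ℕ) ⊆ B → Disjoint T S →
      ∑ b ∈ T, (1 : ℝ) / b < 1 / (2 * (A.card + 1))) :
    ∃ k : ℕ, ∀ a ∈ A, ∀ b ∈ B, b ∉ S → ¬ (b : ℤ) ∣ a + Q * k := by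
  classical
  obtain ⟨C, hC⟩ : ∃ C : ℕ, ∀ a ∈ A, a + Q ≤ C := by
    refine ⟨(∑ a ∈ A, a.toNat) + Q, fun a ha => ?_⟩
    have h1 : a.toNat ≤ ∑ a ∈ A, a.toNat :=
      Finset.single_le_sum (f := fun a : ℤ => a.toNat) (fun _ _ => Nat.zero_le _) ha
    have h2 := Int.self_le_toNat a
    push_cast
    have h3 : (a.toNat : ℤ) ≤ ((∑ a ∈ A, a.toNat : ℕ) : ℤ) := by exact_mod_cast h1
    push_cast at h3
    omega
  obtain ⟨S', hS'B, hS'⟩ := hB.exists_tail_lt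
    (ε := 1 / (4 * (A.card + 1) * (C + 1))) (by positivity)
  set M : ℕ := 4 * A.card * S'.card + 1 with hM
  set T : Finset ℕ := (Finset.range (C * M + 1)).filter (fun b => b ∈ B ∧ b ∉ S) with hT
  have hTB : ∀ b ∈ T, b ∈ B ∧ b ∉ S := fun b hb => (Finset.mem_filter.mp hb).2
  by_contra! hcon
  set bad : ℤ → ℕ → Finset ℕ := fun a b => (Finset.range M).filter (fun k : ℕ => (b : ℤ) ∣ a + Q * k)
  have hcover : Finset.range M ⊆ A.biUnion fun a => T.biUnion fun b => bad a b := by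
    intro k hk
    obtain ⟨a, ha, b, hb, hbS, hd⟩ := hcon k
    simp only [Finset.mem_biUnion]
    refine ⟨a, ha, b, ?_, Finset.mem_filter.mpr ⟨hk, hd⟩⟩
    rw [hT, Finset.mem_filter, Finset.mem_range]
    refine ⟨?_, hb, hbS⟩
    have h0 : 0 < a + Q * k := by have := hA a ha; positivity
    have h1 := Int.le_of_dvd h0 hd
    have h2 : a + Q * k ≤ C * M := by
      have hk' : (k : ℤ) + 1 ≤ M := by have := Finset.mem_range.mp hk; omega
      have ha' := hC a ha
      have := hA a ha
      have hQ0 : (0 : ℤ) ≤ Q := by positivity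
      nlinarith
    have : (b : ℤ) < C * M + 1 := by omega
    exact_mod_cast this
  have hsum : ∀ a : ℤ, ∑ b ∈ T, ((bad a b).card : ℝ) ≤
      M * (1 / (2 * (A.card + 1))) + S'.card + C * M * (1 / (4 * (A.card + 1) * (C + 1))) := by
    intro a
    calc ∑ b ∈ T, ((bad a b).card : ℝ) ≤ ∑ b ∈ T, ((M : ℝ) * (1 / b) + 1) :=
          Finset.sum_le_sum fun b hb =>
            card_filter_dvd_add_mul_le (hB.pos (hTB b hb).1) (hQ b (hTB b hb).1 (hTB b hb).2) a M
      _ = M * ∑ b ∈ T, (1 : ℝ) / b + ∑ b ∈ T, (1 : ℝ) := by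
          rw [Finset.sum_add_distrib, Finset.mul_sum]
      _ = M * ∑ b ∈ T, (1 : ℝ) / b + (∑ b ∈ T.filter (· ∈ S'), (1 : ℝ) +
            ∑ b ∈ T.filter (· ∉ S'), (1 : ℝ)) := by
          rw [Finset.sum_filter_add_sum_filter_not]
      _ ≤ M * (1 / (2 * (A.card + 1))) + (S'.card +
            C * M * (1 / (4 * (A.card + 1) * (C + 1)))) := by
          gcongr
          · refine (hS T (fun b hb => (hTB b hb).1) ?_).le
            exact Finset.disjoint_left.mpr fun b hb => (hTB b hb).2
          · simp only [Finset.sum_const, nsmul_eq_mul, mul_one]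
            exact_mod_cast Finset.card_le_card fun b hb => (Finset.mem_filter.mp hb).2
          · have h1 := (hS' (T.filter (· ∉ S'))
              (fun b hb => (hTB b (Finset.mem_filter.mp hb).1).1)
              (Finset.disjoint_left.mpr fun b hb => (Finset.mem_filter.mp hb).2)).le
            refine le_trans ?_ (mul_le_mul_of_nonneg_left h1 (by positivity))
            rw [Finset.mul_sum]
            refine Finset.sum_le_sum fun b hb => ?_
            have hb' := (Finset.mem_filter.mp hb).1
            have hbpos : (0 : ℝ) < b := by exact_mod_cast hB.pos (hTB b hb').1
            rw [mul_one_div, le_div_iff₀ hbpos, one_mul]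
            have := Finset.mem_range.mp (Finset.mem_filter.mp hb').1
            exact_mod_cast Nat.lt_succ_iff.mp this
      _ = _ := by ring
  have hM1 : (M : ℝ) ≤ ∑ a ∈ A, ∑ b ∈ T, ((bad a b).card : ℝ) := by
    have h1 := Finset.card_le_card hcover
    rw [Finset.card_range] at h1
    have h2 : (A.biUnion fun a => T.biUnion fun b => bad a b).card ≤
        ∑ a ∈ A, ∑ b ∈ T, (bad a b).card :=
      Finset.card_biUnion_le.trans (Finset.sum_le_sum fun a _ => Finset.card_biUnion_le)
    exact_mod_cast h1.trans h2
  have hM2 := hM1.trans (Finset.sum_le_sum fun a _ => hsum a)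
  rw [Finset.sum_const, nsmul_eq_mul] at hM2
  have hc0 : (0 : ℝ) ≤ A.card := by positivity
  have hM0 : (0 : ℝ) < M := by positivity
  have e1 : (A.card : ℝ) * (M * (1 / (2 * (A.card + 1)))) ≤ M / 2 := by
    rw [mul_one_div, ← mul_div_assoc, div_le_div_iff₀ (by positivity) (by positivity)]
    nlinarith
  have e2 : (A.card : ℝ) * (C * M * (1 / (4 * (A.card + 1) * (C + 1)))) ≤ M / 4 := by
    have hC0 : (0 : ℝ) ≤ C := by positivity
    rw [mul_one_div, ← mul_div_assoc, div_le_div_iff₀ (by positivity) (by positivity)]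
    have : (A.card : ℝ) * C ≤ (A.card + 1) * (C + 1) := by nlinarith
    nlinarith
  have e3 : (A.card : ℝ) * S'.card < M / 4 := by
    rw [hM]; push_cast; linarith
  nlinarith

/-- Simultaneous prescription of residues mod finitely many moduli, and of `B`-freeness on a finite
set compatible with one residue system. -/
lemma IsErdos.exists_translate_free (hB : IsErdos B) (A : Finset ℤ) (F : Finset ℕ)
    (hF : (F : Set ℕ) ⊆ B) (r : ℕ → ℤ) (h : ∀ b ∈ B, ∀ a ∈ A, ¬ (b : ℤ) ∣ a + r b) :
    ∃ t : ℤ, (∀ b ∈ F, (b : ℤ) ∣ t - r b) ∧ ∀ a ∈ A, ∀ b ∈ B, ¬ (b : ℤ) ∣ a + t := by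
  classical
  obtain ⟨S, hFS, hSB, hS⟩ := hB.exists_tail_lt_of_subset
    (ε := 1 / (2 * (A.card + 1))) (by positivity) F hF
  obtain ⟨t₀, ht₀⟩ := exists_int_dvd_sub S (fun b hb => hB.pos (hSB hb))
    (fun a ha b hb => hB.coprime (hSB ha) (hSB hb)) r
  set Q := ∏ c ∈ S, c with hQ
  have hQ0 : (1 : ℤ) ≤ Q := by exact_mod_cast hB.prod_pos hSB
  obtain ⟨K, hK0, hK⟩ : ∃ K : ℤ, 0 ≤ K ∧ ∀ a ∈ A, 0 < a + (t₀ + Q * K) := by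
    refine ⟨|t₀| + (∑ a ∈ A, |a|) + 1, by positivity, fun a ha => ?_⟩
    have h1 : |a| ≤ ∑ a ∈ A, |a| :=
      Finset.single_le_sum (f := fun a : ℤ => |a|) (fun _ _ => abs_nonneg _) ha
    have h2 := neg_abs_le a
    have h3 := neg_abs_le t₀
    have h4 : |t₀| + (∑ a ∈ A, |a|) + 1 ≤ Q * (|t₀| + (∑ a ∈ A, |a|) + 1) :=
      le_mul_of_one_le_left (by positivity) hQ0
    omega
  obtain ⟨k, hk⟩ := hB.exists_progression_free S Q (fun b hb hbS => hB.coprime_prod hSB hb hbS)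
    (A.image fun a => a + (t₀ + Q * K))
    (by intro a ha; obtain ⟨a', ha', rfl⟩ := Finset.mem_image.mp ha; exact hK a' ha')
    (by rwa [Finset.card_image_of_injective _ (add_left_injective _)])
  have hres : ∀ b ∈ S, (b : ℤ) ∣ t₀ + Q * K + Q * k - r b := by
    intro b hb
    have h1 : (b : ℤ) ∣ Q := by exact_mod_cast Finset.dvd_prod_of_mem _ hb
    have h2 : t₀ + Q * K + Q * k - r b = (t₀ - r b) + Q * (K + k) := by ring
    rw [h2]
    exact dvd_add (ht₀ b hb) (h1.mul_right _)
  refine ⟨t₀ + Q * K + Q * k, fun b hb => hres b (hFS hb), fun a ha b hb hd => ?_⟩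
  by_cases hbS : b ∈ S
  · refine h b hb a ha ?_
    have h2 : a + r b = a + (t₀ + Q * K + Q * k) - (t₀ + Q * K + Q * k - r b) := by ring
    rw [h2]
    exact dvd_sub hd (hres b hbS)
  · refine hk _ (Finset.mem_image_of_mem _ ha) b hb hbS ?_
    rwa [add_assoc]

end Erdos

section Subshift

open Topology

variable {B : Set ℕ}

open Classical in
/-- The indicator sequence of a set of integers. -/
noncomputable def ind (A : Set ℤ) : ℤ → Bool := fun n => decide (n ∈ A)

lemma ind_eq_true {A : Set ℤ} {n : ℤ} : ind A n = true ↔ n ∈ A := by simp [ind]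

lemma supp_ind (A : Set ℤ) : supp (ind A) = A := by ext n; exact ind_eq_true

lemma ind_eq_ind {A A' : Set ℤ} {n : ℤ} (h : n ∈ A ↔ n ∈ A') : ind A n = ind A' n := by
  rw [Bool.eq_iff_iff, ind_eq_true, ind_eq_true, h]

lemma ind_mem_XB {A : Set ℤ} : ind A ∈ XB B ↔ IsBAdmissible B A := by
  rw [XB, Set.mem_ofPred_eq, supp_ind]

lemma IsBAdmissible.mono {A A' : Set ℤ} (h : IsBAdmissible B A) (hA : A' ⊆ A) :
    IsBAdmissible B A' := fun b hb => (h b hb).imp fun _ hr a ha => hr a (hA ha)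

lemma eta_eq_true {n : ℤ} : eta B n = true ↔ ∀ b ∈ B, ¬ (b : ℤ) ∣ n := by
  unfold eta BFreeSet
  split_ifs with h
  · exact iff_of_true rfl h
  · exact iff_of_false id h

lemma exists_finset_of_mem_nhds {x : ℤ → Bool} {s : Set (ℤ → Bool)} (h : s ∈ 𝓝 x) :
    ∃ F : Finset ℤ, ∀ y : ℤ → Bool, (∀ i ∈ F, y i = x i) → y ∈ s := by
  rw [nhds_pi, Filter.mem_pi] at h
  obtain ⟨I, hI, t, ht, hs⟩ := h
  refine ⟨hI.toFinset, fun y hy => hs fun i hi => ?_⟩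
  rw [hy i (hI.mem_toFinset.mpr hi)]
  exact mem_of_mem_nhds (ht i)

lemma setOf_agree_mem_nhds (x : ℤ → Bool) (F : Finset ℤ) :
    {y : ℤ → Bool | ∀ i ∈ F, y i = x i} ∈ 𝓝 x := by
  have h := set_pi_mem_nhds (i := (F : Set ℤ)) (s := fun i => {x i}) (x := x) F.finite_toSet
    (fun i _ => mem_nhds_discrete.mpr rfl)
  exact h

lemma mem_closure_iff_agree {x : ℤ → Bool} {Y : Set (ℤ → Bool)} :
    x ∈ closure Y ↔ ∀ F : Finset ℤ, ∃ y ∈ Y, ∀ i ∈ F, y i = x i := by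
  rw [mem_closure_iff_nhds]
  constructor
  · intro h F
    obtain ⟨y, hy, hyY⟩ := h _ (setOf_agree_mem_nhds x F)
    exact ⟨y, hyY, hy⟩
  · intro h s hs
    obtain ⟨F, hF⟩ := exists_finset_of_mem_nhds hs
    obtain ⟨y, hyY, hy⟩ := h F
    exact ⟨y, hF y hy, hyY⟩

lemma IsErdos.exists_injective (hB : IsErdos B) (R : ℕ) :
    ∃ f : ℤ → ℕ, Function.Injective f ∧ ∀ n, f n ∈ B ∧ R < f n := by
  have hinf : (B \ Set.Iic R).Infinite := hB.1.sdiff (Set.finite_Iic R)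
  refine ⟨fun n => hinf.natEmbedding _ (Encodable.encode n), ?_, fun n => ?_⟩
  · intro m n h
    exact Encodable.encode_injective ((hinf.natEmbedding _).injective (Subtype.ext h))
  · have := (hinf.natEmbedding _ (Encodable.encode n)).2
    exact ⟨this.1, not_le.mp this.2⟩

lemma int_dvd_small {b : ℕ} {m : ℤ} (h : (b : ℤ) ∣ m) (hm : |m| < b) : m = 0 :=
  Int.eq_zero_of_abs_lt_dvd h hm

lemma IsErdos.Xeta_eq_XB (hB : IsErdos B) : Xeta B = XB B := by
  classical
  ext x
  rw [Xeta, mem_closure_iff_agree]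
  constructor
  · intro h b hb
    by_contra! hcon
    choose a ha hd using hcon
    obtain ⟨y, ⟨t, rfl⟩, hy⟩ := h ((Finset.Ico (0 : ℤ) b).image a)
    have hb' : (0 : ℤ) < b := by exact_mod_cast hB.pos hb
    set r := (-t) % (b : ℤ) with hr
    have hmem : a r ∈ (Finset.Ico (0 : ℤ) b).image a := Finset.mem_image_of_mem _
      (Finset.mem_Ico.mpr ⟨Int.emod_nonneg _ hb'.ne', Int.emod_lt_of_pos _ hb'⟩)
    have h1 : eta B (a r + t) = true := (hy _ hmem).trans (ha r)
    refine eta_eq_true.mp h1 b hb ?_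
    have h2 : (b : ℤ) ∣ r - -t := (Int.modEq_iff_dvd.mp (Int.mod_modEq (-t) b).symm)
    have h3 : a r + t = (a r - r) + (r - -t) := by ring
    rw [h3]
    exact dvd_add (hd r) h2
  · intro h F
    obtain ⟨m, hm⟩ : ∃ m : ℕ, ∀ i ∈ F, |i| ≤ m := by
      refine ⟨∑ i ∈ F, i.natAbs, fun i hi => ?_⟩
      have h1 : i.natAbs ≤ ∑ i ∈ F, i.natAbs :=
        Finset.single_le_sum (f := fun i : ℤ => i.natAbs) (fun _ _ => Nat.zero_le _) hi
      have h2 : (i.natAbs : ℤ) ≤ ((∑ i ∈ F, i.natAbs : ℕ) : ℤ) := by exact_mod_cast h1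
      rwa [Int.natCast_natAbs] at h2
    obtain ⟨f, hf, hfB⟩ := hB.exists_injective (2 * m)
    have hs : ∀ b : ℕ, ∃ s : ℤ, b ∈ B → ∀ a ∈ supp x, ¬ (b : ℤ) ∣ a - s := by
      intro b
      by_cases hb : b ∈ B
      · obtain ⟨s, hs⟩ := h b hb
        exact ⟨s, fun _ => hs⟩
      · exact ⟨0, fun h => absurd h hb⟩
    choose s hs using hs
    set E := F.filter (fun i => x i = true) with hE
    set E' := F.filter (fun i => ¬ x i = true) with hE'
    set r : ℕ → ℤ := fun b => if ∃ i ∈ E', f i = b then -(Function.invFun f b) else - s b with hr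
    have hrf : ∀ i ∈ E', r (f i) = -i := by
      intro i hi
      simp only [hr]
      rw [if_pos ⟨i, hi, rfl⟩, Function.leftInverse_invFun hf i]
    obtain ⟨t, ht1, ht2⟩ := hB.exists_translate_free E (E'.image f)
      (by intro b hb
          obtain ⟨i, -, rfl⟩ := Finset.mem_image.mp (Finset.mem_coe.mp hb)
          exact (hfB i).1) r
      (by intro b hb a ha hd
          rw [hE, Finset.mem_filter] at ha
          by_cases hex : ∃ i ∈ E', f i = b
          · obtain ⟨i, hi, rfl⟩ := hex
            rw [hrf i hi] at hd
            rw [hE', Finset.mem_filter] at hi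
            have h1 := abs_le.mp (hm a ha.1)
            have h2 := abs_le.mp (hm i hi.1)
            have h3 := (hfB i).2
            have h4 : a + -i = 0 := int_dvd_small hd (abs_lt.mpr ⟨by omega, by omega⟩)
            have h5 : a = i := by omega
            exact hi.2 (h5 ▸ ha.2)
          · simp only [hr] at hd
            rw [if_neg hex, ← sub_eq_add_neg] at hd
            exact hs b hb a ha.2 hd)
    refine ⟨_, ⟨t, rfl⟩, fun i hi => ?_⟩
    change eta B (i + t) = x i
    by_cases hx : x i = true
    · rw [hx, eta_eq_true]
      exact ht2 i (Finset.mem_filter.mpr ⟨hi, hx⟩)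
    · have hi' : i ∈ E' := Finset.mem_filter.mpr ⟨hi, hx⟩
      have h1 := ht1 (f i) (Finset.mem_image_of_mem _ hi')
      rw [hrf i hi'] at h1
      rw [Bool.eq_iff_iff, eta_eq_true]
      refine iff_of_false (fun h2 => h2 (f i) (hfB i).1 ?_) hx
      convert h1 using 1
      ring

/-- `η` is a maximal element of the admissible subshift. -/
lemma IsErdos.eq_eta_of_le (hB : IsErdos B) {x : ℤ → Bool} (hx : x ∈ XB B)
    (h : ∀ n, eta B n = true → x n = true) : x = eta B := by
  classical
  have hle : ∀ n, x n = true → eta B n = true := by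
    intro n hn
    rw [eta_eq_true]
    intro b hb hd
    obtain ⟨r, hr⟩ := hx b hb
    have hrb : ¬ (b : ℤ) ∣ r := fun h0 => hr n hn (dvd_sub hd h0)
    obtain ⟨t, ht1, ht2⟩ := hB.exists_translate_free {0} {b} (by simpa using hb)
      (fun c => if c = b then r else 1) (by
        intro c hc a ha hd
        rw [Finset.mem_singleton] at ha
        rw [ha, zero_add] at hd
        split_ifs at hd with hcb
        · exact hrb (hcb ▸ hd)
        · have := hB.2.1 c hc
          have := Int.le_of_dvd one_pos hd
          omega)
    have h1 := ht1 b (Finset.mem_singleton_self b)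
    rw [if_pos rfl] at h1
    refine hr t (h t ?_) h1
    rw [eta_eq_true]
    simpa using ht2 0 (Finset.mem_singleton_self 0)
  funext n
  rw [Bool.eq_iff_iff]
  exact ⟨hle n, h n⟩

lemma shiftPow_eta_mem (t : ℤ) : shiftPow t (eta B) ∈ Xeta B := subset_closure ⟨t, rfl⟩

lemma shiftPow_mem_XB {x : ℤ → Bool} (hx : x ∈ XB B) (t : ℤ) : shiftPow t x ∈ XB B := by
  intro b hb
  obtain ⟨r, hr⟩ := hx b hb
  refine ⟨r - t, fun a ha hd => hr (a + t) ha ?_⟩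
  convert hd using 1
  ring

lemma shiftPow_shiftPow (s t : ℤ) (x : ℤ → Bool) : shiftPow s (shiftPow t x) = shiftPow (s + t) x := by
  funext n
  simp [shiftPow, add_assoc]

lemma shiftPow_zero (x : ℤ → Bool) : shiftPow 0 x = x := by funext n; simp [shiftPow]

lemma IsCA.map_shiftPow {τ : (ℤ → Bool) → (ℤ → Bool)} (hτ : IsCA (XB B) τ) {x : ℤ → Bool}
    (hx : x ∈ XB B) (t : ℤ) : τ (shiftPow t x) = shiftPow t (τ x) := by
  induction t with
  | zero => rw [shiftPow_zero, shiftPow_zero]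
  | succ k ih =>
    have h := hτ.2.2 _ (shiftPow_mem_XB hx k)
    rw [shift, shiftPow_shiftPow, ih, shiftPow_shiftPow, add_comm] at h
    exact h
  | pred k ih =>
    have h := hτ.2.2 _ (shiftPow_mem_XB hx (-(k : ℤ) - 1))
    rw [shift, shiftPow_shiftPow, show (1 : ℤ) + (-(k : ℤ) - 1) = -(k : ℤ) by ring, ih] at h
    have h2 := congrArg (shiftPow (-1)) h
    rw [shiftPow_shiftPow, shiftPow_shiftPow] at h2
    simpa [shiftPow_zero, sub_eq_add_neg, add_comm] using h2.symm

/-- A continuous shift-commuting map is a sliding block code. -/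
lemma IsCA.exists_hasRadius {τ : (ℤ → Bool) → (ℤ → Bool)} (hτ : IsCA (XB B) τ)
    (hclosed : IsClosed (XB B)) : ∃ ℓ : ℕ, HasRadius (XB B) τ ℓ := by
  classical
  have hloc : ∀ x : ℤ → Bool, ∃ F : Finset ℤ, x ∈ XB B →
      ∀ y ∈ XB B, (∀ i ∈ F, y i = x i) → τ y 0 = τ x 0 := by
    intro x
    by_cases hx : x ∈ XB B
    · have h1 : {z : ℤ → Bool | ∀ i ∈ ({0} : Finset ℤ), z i = τ x i} ∈ 𝓝 (τ x) :=
        setOf_agree_mem_nhds _ _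
      have h2 := hτ.2.1 x hx h1
      rw [Filter.mem_map, mem_nhdsWithin_iff_exists_mem_nhds_inter] at h2
      obtain ⟨u, hu, hu'⟩ := h2
      obtain ⟨F, hF⟩ := exists_finset_of_mem_nhds hu
      refine ⟨F, fun _ y hy hagree => ?_⟩
      exact hu' ⟨hF y hagree, hy⟩ 0 (Finset.mem_singleton_self 0)
    · exact ⟨∅, fun h => absurd h hx⟩
  choose F hF using hloc
  obtain ⟨T, hT, hcov⟩ := hclosed.isCompact.elim_nhds_subcover
    (fun x => {y : ℤ → Bool | ∀ i ∈ F x, y i = x i}) (fun x _ => setOf_agree_mem_nhds x (F x))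
  refine ⟨∑ x ∈ T, ∑ i ∈ F x, i.natAbs, fun x hx y hy n hxy => ?_⟩
  have h0 : ∀ x ∈ XB B, ∀ y ∈ XB B, (∀ i : ℤ, |i| ≤ ((∑ x ∈ T, ∑ i ∈ F x, i.natAbs : ℕ) : ℤ) →
      x i = y i) → τ x 0 = τ y 0 := by
    intro x hx y hy hxy
    obtain ⟨z, hz, hxz⟩ := Set.mem_iUnion₂.mp (hcov hx)
    rw [hF z (hT z hz) x hx hxz]
    refine (hF z (hT z hz) y hy fun i hi => ?_).symm
    rw [← hxz i hi]
    refine (hxy i ?_).symm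
    rw [← Int.natCast_natAbs]
    have h1 : i.natAbs ≤ ∑ i ∈ F z, i.natAbs :=
      Finset.single_le_sum (f := fun i : ℤ => i.natAbs) (fun _ _ => Nat.zero_le _) hi
    have h2 : ∑ i ∈ F z, i.natAbs ≤ ∑ x ∈ T, ∑ i ∈ F x, i.natAbs :=
      Finset.single_le_sum (f := fun x => ∑ i ∈ F x, i.natAbs) (fun _ _ => Nat.zero_le _) hz
    exact_mod_cast h1.trans h2
  have h1 := h0 _ (shiftPow_mem_XB hx n) _ (shiftPow_mem_XB hy n) fun i hi =>
    hxy (i + n) (by have := abs_le.mp hi; omega) (by have := abs_le.mp hi; omega)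
  rw [hτ.map_shiftPow hx, hτ.map_shiftPow hy] at h1
  simpa [shiftPow] using h1

end Subshift

section Code

variable {B : Set ℕ}

/-- A finite admissible set missing the class of `n` mod `b` can be enlarged by far apart points in
all the other classes mod `b`. -/
lemma IsErdos.exists_spread (hB : IsErdos B) (C : Finset ℤ) (hC : IsBAdmissible B C) {b : ℕ}
    (hb : b ∈ B) (n : ℤ) (hn : ∀ e ∈ C, ¬ (b : ℤ) ∣ e - n) (R : ℕ) :
    ∃ a : ℕ → ℤ, (∀ c, (b : ℤ) ∣ a c - (n + c)) ∧ (∀ c c', c ≠ c' → (R : ℤ) < |a c - a c'|) ∧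
      (∀ c, ∀ e ∈ C, (R : ℤ) < |a c - e|) ∧
      IsBAdmissible B ((C : Set ℤ) ∪ a '' (Finset.Ico 1 b : Finset ℕ)) := by
  classical
  have hs : ∀ b : ℕ, ∃ s : ℤ, b ∈ B → ∀ a ∈ C, ¬ (b : ℤ) ∣ a - s := by
    intro b
    by_cases hb : b ∈ B
    · obtain ⟨s, hs⟩ := hC b hb
      exact ⟨s, fun _ => hs⟩
    · exact ⟨0, fun h => absurd h hb⟩
  choose s hs using hs
  set S := (Finset.range (C.card + b + 1)).filter (· ∈ B) with hS
  have hSB : (S : Set ℕ) ⊆ B := fun c hc => (Finset.mem_filter.mp (Finset.mem_coe.mp hc)).2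
  have hbS : b ∈ S := Finset.mem_filter.mpr ⟨Finset.mem_range.mpr (by omega), hb⟩
  choose z hz using fun c : ℕ => exists_int_dvd_sub S (fun b hb => hB.pos (hSB hb))
    (fun a ha b hb => hB.coprime (hSB ha) (hSB hb))
    (fun d => if d = b then n + c else s d + 1)
  set P := ∏ c ∈ S, c with hP
  have hP0 : (1 : ℤ) ≤ P := by exact_mod_cast hB.prod_pos hSB
  obtain ⟨E, hE⟩ : ∃ E : ℕ, ∀ i ∈ C, |i| ≤ E := by
    refine ⟨∑ i ∈ C, i.natAbs, fun i hi => ?_⟩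
    have h1 : i.natAbs ≤ ∑ i ∈ C, i.natAbs :=
      Finset.single_le_sum (f := fun i : ℤ => i.natAbs) (fun _ _ => Nat.zero_le _) hi
    have h2 : (i.natAbs : ℤ) ≤ ((∑ i ∈ C, i.natAbs : ℕ) : ℤ) := by exact_mod_cast h1
    rwa [Int.natCast_natAbs] at h2
  set M : ℤ := R + E + 2 with hM
  set a : ℕ → ℤ := fun c => z c % P + P * (M * (c + 1)) with ha
  have ha_res : ∀ c, ∀ d ∈ S, (d : ℤ) ∣ a c - (if d = b then n + c else s d + 1) := by
    intro c d hd
    have h1 : (d : ℤ) ∣ P := by exact_mod_cast Finset.dvd_prod_of_mem _ hd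
    have h2 : (P : ℤ) ∣ a c - z c := by
      refine ⟨M * (c + 1) - z c / P, ?_⟩
      have := Int.emod_add_mul_ediv (z c) P
      simp only [ha]
      linear_combination this
    have h3 := dvd_add (h1.trans h2) (hz c d hd)
    rwa [sub_add_sub_cancel] at h3
  have hz0 : ∀ c, 0 ≤ z c % P := fun c => Int.emod_nonneg _ (by omega)
  have hz1 : ∀ c, z c % P < P := fun c => Int.emod_lt_of_pos _ (by omega)
  have hR0 : (0 : ℤ) ≤ R := by positivity
  have hE0 : (0 : ℤ) ≤ E := by positivity
  have hlt : ∀ c c', c < c' → (R : ℤ) < a c' - a c := by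
    intro c c' h
    have h' : (c : ℤ) + 1 ≤ c' := by exact_mod_cast h
    have e1 : a c' - a c = z c' % P - z c % P + P * (M * (c' - c)) := by simp only [ha]; ring
    have e2 : M ≤ M * (c' - c) := le_mul_of_one_le_right (by omega) (by omega)
    have e3 : P * M ≤ P * (M * (c' - c)) := mul_le_mul_of_nonneg_left e2 (by omega)
    have e4 : (R : ℤ) + 1 ≤ P * (R + E + 1) := by nlinarith
    have e5 : P * M = P * (R + E + 1) + P := by rw [hM]; ring
    have := hz0 c'
    have := hz1 c
    omega
  have hab : ∀ c, (b : ℤ) ∣ a c - (n + c) := fun c => by simpa using ha_res c b hbS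
  refine ⟨a, hab, ?_, ?_, ?_⟩
  · intro c c' h
    rcases lt_or_gt_of_ne h with h | h
    · rw [abs_sub_comm]
      exact (hlt _ _ h).trans_le (le_abs_self _)
    · exact (hlt _ _ h).trans_le (le_abs_self _)
  · intro c e he
    refine lt_of_lt_of_le ?_ (le_abs_self _)
    have e1 : M ≤ M * (c + 1) := le_mul_of_one_le_right (by omega) (by omega)
    have e2 : M * (c + 1) ≤ P * (M * (c + 1)) := le_mul_of_one_le_left (by omega) hP0
    have e3 := abs_le.mp (hE e he)
    have := hz0 c
    simp only [ha]
    omega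
  · intro d hd
    rcases eq_or_ne d b with rfl | hdb
    · refine ⟨n, fun e he => ?_⟩
      rcases he with he | ⟨c, hc, rfl⟩
      · exact hn e he
      · intro hdv
        rw [Finset.mem_coe, Finset.mem_Ico] at hc
        have h1 := dvd_sub hdv (hab c)
        have h2 : a c - n - (a c - (n + c)) = c := by ring
        rw [h2] at h1
        have := Nat.le_of_dvd (by omega) (Int.natCast_dvd_natCast.mp h1)
        omega
    · by_cases hdS : d ∈ S
      · refine ⟨s d, fun e he => ?_⟩
        rcases he with he | ⟨c, hc, rfl⟩
        · exact hs d hd e he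
        · intro hdv
          have h1 := ha_res c d hdS
          rw [if_neg hdb] at h1
          have h2 := dvd_sub hdv h1
          have h3 : a c - s d - (a c - (s d + 1)) = 1 := by ring
          rw [h3] at h2
          have := Int.le_of_dvd one_pos h2
          have := hB.2.1 d hd
          omega
      · have hdl : C.card + b < d := by
          by_contra hlt
          exact hdS (Finset.mem_filter.mpr ⟨Finset.mem_range.mpr (by omega), hd⟩)
        have hcard : (C ∪ (Finset.Ico 1 b).image a).card < d := by
          have h1 := Finset.card_union_le C ((Finset.Ico 1 b).image a)
          have h2 := Finset.card_image_le (s := Finset.Ico 1 b) (f := a)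
          rw [Nat.card_Ico] at h2
          omega
        obtain ⟨r, hr⟩ := exists_residue_avoided _ hcard
        refine ⟨r, fun e he => hr e ?_⟩
        rw [← Finset.coe_image, ← Finset.coe_union] at he
        exact he

lemma ind_empty_mem_XB : ind ∅ ∈ XB B :=
  ind_mem_XB.mpr fun _ _ => ⟨0, fun _ h => absurd h (Set.notMem_empty _)⟩

lemma IsErdos.admissible_singleton (hB : IsErdos B) (m : ℤ) : IsBAdmissible B {m} := by
  intro b hb
  refine ⟨m - 1, fun a ha hd => ?_⟩
  rw [Set.mem_singleton_iff.mp ha, sub_sub_cancel] at hd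
  have := Int.le_of_dvd one_pos hd
  have := hB.2.1 b hb
  omega

variable {τ : (ℤ → Bool) → (ℤ → Bool)}

lemma IsErdos.ca_zero (hB : IsErdos B) (hτ : IsCA (XB B) τ) (n : ℤ) : τ (ind ∅) n = false := by
  by_contra h
  rw [Bool.not_eq_false] at h
  have hsh : ∀ t, shiftPow t (ind ∅) = ind ∅ := by
    intro t
    funext m
    exact ind_eq_ind Iff.rfl
  obtain ⟨b, hb⟩ := hB.1.nonempty
  obtain ⟨r, hr⟩ := hτ.1 ind_empty_mem_XB b hb
  refine hr r ?_ (by simp)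
  have h1 := congrFun (hτ.map_shiftPow ind_empty_mem_XB (r - n)) n
  rw [hsh] at h1
  rw [h1] at h
  simpa [shiftPow, supp] using h

lemma IsErdos.ca_singleton (hB : IsErdos B) (hτ : IsCA (XB B) τ) (m n : ℤ) :
    τ (ind {m}) n = τ (ind {0}) (n - m) := by
  have h1 : shiftPow (-m) (ind {0}) = ind {m} := by
    funext k
    rw [Bool.eq_iff_iff]
    simp [shiftPow, ind_eq_true, add_neg_eq_zero]
  rw [← h1, hτ.map_shiftPow (ind_mem_XB.mpr (hB.admissible_singleton 0)), shiftPow, sub_eq_add_neg]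

variable {ℓ : ℕ}

/-- Outputs require an input symbol `1` in the window. -/
lemma IsErdos.exists_near (hB : IsErdos B) (hτ : IsCA (XB B) τ) (hℓ : HasRadius (XB B) τ ℓ)
    {x : ℤ → Bool} (hx : x ∈ XB B) {n : ℤ} (h : τ x n = true) :
    ∃ i, n - ℓ ≤ i ∧ i ≤ n + ℓ ∧ x i = true := by
  by_contra! hcon
  have h1 : τ x n = τ (ind ∅) n := hℓ x hx _ ind_empty_mem_XB n fun i h1 h2 => by
    rw [Bool.eq_false_iff.mpr (hcon i h1 h2)]
    simp [ind]
  rw [h1, hB.ca_zero hτ] at h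
  exact Bool.false_ne_true h

/-- The residue class missed by the image of a finite configuration surrounded by isolated points. -/
lemma IsErdos.exists_missed_class (hB : IsErdos B) (hτ : IsCA (XB B) τ)
    (hℓ : HasRadius (XB B) τ ℓ) (C : Finset ℤ) (hC : IsBAdmissible B C) {b : ℕ} (hb : b ∈ B)
    (n : ℤ) (hn : ∀ e ∈ C, ¬ (b : ℤ) ∣ e - n) :
    ∃ s : ℤ, (∀ u, τ (ind {0}) u = true → (b : ℤ) ∣ s - n - u) ∧
      ∀ m, τ (ind C) m = true → ¬ (b : ℤ) ∣ m - s := by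
  obtain ⟨a, ha, haa, haC, hadm⟩ := hB.exists_spread C hC hb n hn (2 * ℓ)
  push_cast at haa haC
  set D : Set ℤ := (C : Set ℤ) ∪ a '' (Finset.Ico 1 b : Finset ℕ) with hD
  have hx := ind_mem_XB.mpr hadm
  obtain ⟨s, hs⟩ := hτ.1 hx b hb
  have hb0 : (0 : ℤ) < b := by exact_mod_cast hB.pos hb
  refine ⟨s, fun u hu => ?_, fun m hm => hs m ?_⟩
  · by_contra hnd
    set c := ((s - u - n) % b).toNat with hc
    have hc' : (c : ℤ) = (s - u - n) % b := Int.toNat_of_nonneg (Int.emod_nonneg _ hb0.ne')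
    have hclt : (c : ℤ) < b := hc' ▸ Int.emod_lt_of_pos _ hb0
    have hcdvd : (b : ℤ) ∣ (s - u - n) - c := by
      rw [hc']; exact Int.modEq_iff_dvd.mp (Int.mod_modEq _ _)
    have hc0 : c ≠ 0 := by
      intro h0
      apply hnd
      rw [h0] at hcdvd
      convert hcdvd using 1
      push_cast
      ring
    have hcmem : c ∈ Finset.Ico 1 b := Finset.mem_Ico.mpr ⟨by omega, by omega⟩
    obtain ⟨i, hi1, hi2, hi⟩ := hB.exists_near hτ hℓ
      (ind_mem_XB.mpr (hB.admissible_singleton 0)) hu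
    rw [ind_eq_true, Set.mem_singleton_iff] at hi
    subst hi
    have h1 : τ (ind D) (a c + u) = τ (ind {a c}) (a c + u) := by
      refine hℓ _ hx _ (ind_mem_XB.mpr (hB.admissible_singleton _)) _ fun i hi1 hi2 => ind_eq_ind ?_
      rw [Set.mem_singleton_iff]
      constructor
      · rintro (hi | ⟨c', -, rfl⟩)
        · have := lt_abs.mp (haC c i hi)
          omega
        · by_contra hne
          have := lt_abs.mp (haa c' c fun h => hne (by rw [h]))
          omega
      · rintro rfl
        exact Or.inr ⟨c, hcmem, rfl⟩
    rw [hB.ca_singleton hτ, add_sub_cancel_left, hu] at h1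
    refine hs _ h1 ?_
    have h2 : a c + u - s = (a c - (n + c)) - (s - u - n - c) := by ring
    rw [h2]
    exact dvd_sub (ha c) hcdvd
  · have hxC := ind_mem_XB.mpr hC
    obtain ⟨e, he1, he2, he⟩ := hB.exists_near hτ hℓ hxC hm
    rw [ind_eq_true] at he
    rw [supp, Set.mem_ofPred_eq, ← hm]
    refine hℓ _ hx _ hxC _ fun i hi1 hi2 => ind_eq_ind ?_
    constructor
    · rintro (hi | ⟨c', -, rfl⟩)
      · exact hi
      · have := lt_abs.mp (haC c' e he)
        omega
    · exact fun hi => Or.inl hi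

lemma IsErdos.exists_gt (hB : IsErdos B) (R : ℕ) : ∃ b ∈ B, R < b := hB.1.exists_gt R

/-- If a single `1` has a nonempty image, the CA is dominated by a shift power. -/
lemma IsErdos.ca_le_shiftPow (hB : IsErdos B) (hτ : IsCA (XB B) τ) (hℓ : HasRadius (XB B) τ ℓ)
    {u : ℤ} (hu : τ (ind {0}) u = true) {x : ℤ → Bool} (hx : x ∈ XB B) {m : ℤ}
    (hm : τ x m = true) : x (m - u) = true := by
  classical
  by_contra hxm
  set C : Finset ℤ := (Finset.Icc (m - ℓ) (m + ℓ)).filter (fun i => x i = true) with hCdef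
  have hC : IsBAdmissible B C := IsBAdmissible.mono (A := supp x) hx fun i hi =>
    (Finset.mem_filter.mp (Finset.mem_coe.mp hi)).2
  have hmC : τ (ind C) m = true := by
    rw [← hm]
    refine hℓ _ (ind_mem_XB.mpr hC) _ hx _ fun i h1 h2 => ?_
    rw [Bool.eq_iff_iff, ind_eq_true, Finset.mem_coe, hCdef, Finset.mem_filter, Finset.mem_Icc]
    exact ⟨fun h => h.2, fun h => ⟨⟨h1, h2⟩, h⟩⟩
  obtain ⟨b, hb, hbl⟩ := hB.exists_gt (ℓ + u.natAbs)
  have hbl' : (ℓ : ℤ) + |u| < b := by rw [← Int.natCast_natAbs]; exact_mod_cast hbl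
  obtain ⟨s, hs1, hs2⟩ := hB.exists_missed_class hτ hℓ C hC hb (m - u) (by
    intro e he hd
    rw [hCdef, Finset.mem_filter, Finset.mem_Icc] at he
    have h1 := neg_abs_le u
    have h2 := le_abs_self u
    have h3 := int_dvd_small hd (abs_lt.mpr ⟨by omega, by omega⟩)
    rw [sub_eq_zero] at h3
    exact hxm (h3 ▸ he.2))
  refine hs2 m hmC ?_
  have h1 := hs1 u hu
  rwa [sub_sub, sub_add_cancel, ← dvd_neg, neg_sub] at h1

end Code

section Counting

variable {B : Set ℕ}

/-- The integers divisible by no element of the finite set `S`. -/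
def sieved (S : Finset ℕ) : Set ℤ := {n | ∀ b ∈ S, ¬ (b : ℤ) ∣ n}

open Classical in
lemma card_filter_shift_le (p : Set ℤ) (N : ℕ) (hN : 0 < N)
    (hp : ∀ n, n % (N : ℤ) ∈ p ↔ n ∈ p) (r : ℤ) (ℓ : ℕ) :
    ((Finset.Ico (-(ℓ : ℤ)) (N + ℓ)).filter (fun n => n - r ∈ p)).card ≤
      ((Finset.Ico (0 : ℤ) N).filter (· ∈ p)).card + 2 * ℓ := by
  have hN' : (0 : ℤ) < N := by exact_mod_cast hN
  have hmid : ((Finset.Ico (0 : ℤ) N).filter (fun n => n - r ∈ p)).card ≤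
      ((Finset.Ico (0 : ℤ) N).filter (· ∈ p)).card := by
    refine Finset.card_le_card_of_injOn (fun n => (n - r) % (N : ℤ)) ?_ ?_
    · intro n hn
      rw [Finset.mem_coe, Finset.mem_filter] at hn ⊢
      exact ⟨Finset.mem_Ico.mpr ⟨Int.emod_nonneg _ hN'.ne', Int.emod_lt_of_pos _ hN'⟩,
        (hp _).mpr hn.2⟩
    · intro n hn m hm h
      rw [Finset.mem_coe, Finset.mem_filter, Finset.mem_Ico] at hn hm
      have h1 : (N : ℤ) ∣ m - r - (n - r) := Int.modEq_iff_dvd.mp h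
      have h2 := int_dvd_small h1 (abs_lt.mpr ⟨by omega, by omega⟩)
      omega
  have hsub : (Finset.Ico (-(ℓ : ℤ)) (N + ℓ)).filter (fun n => n - r ∈ p) ⊆
      (Finset.Ico (0 : ℤ) N).filter (fun n => n - r ∈ p) ∪
        (Finset.Ico (-(ℓ : ℤ)) 0 ∪ Finset.Ico (N : ℤ) (N + ℓ)) := by
    intro n hn
    simp only [Finset.mem_filter, Finset.mem_union, Finset.mem_Ico] at hn ⊢
    by_cases h1 : 0 ≤ n
    · by_cases h2 : n < N
      · exact Or.inl ⟨⟨h1, h2⟩, hn.2⟩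
      · exact Or.inr (Or.inr ⟨by omega, hn.1.2⟩)
    · exact Or.inr (Or.inl ⟨hn.1.1, by omega⟩)
  have h1 := Finset.card_le_card hsub
  have h2 := Finset.card_union_le ((Finset.Ico (0 : ℤ) N).filter (fun n => n - r ∈ p))
    (Finset.Ico (-(ℓ : ℤ)) 0 ∪ Finset.Ico (N : ℤ) (N + ℓ))
  have h3 := Finset.card_union_le (Finset.Ico (-(ℓ : ℤ)) 0) (Finset.Ico (N : ℤ) (N + ℓ))
  simp only [Int.card_Ico] at h3
  omega

open Classical in
/-- A lower bound for the number of sieved integers in a residue class modulo a partial product. -/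
lemma IsErdos.le_card_sieved_class (hB : IsErdos B) {S₀ S : Finset ℕ} (hS : (S : Set ℕ) ⊆ B)
    (hS₀ : S₀ ⊆ S) (hsum : ∑ b ∈ S \ S₀, (1 : ℝ) / b ≤ 1 / 2) (t : ℤ) (ht : t ∈ sieved S₀)
    {N : ℕ} (hN : (∏ c ∈ S, c) ∣ N) :
    (N : ℝ) / (2 * (∏ c ∈ S₀, c : ℕ)) ≤ ((Finset.Ico (0 : ℤ) N).filter
      (fun n => n ∈ sieved S ∧ ((∏ c ∈ S₀, c : ℕ) : ℤ) ∣ n - t)).card := by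
  have hS₀B : (S₀ : Set ℕ) ⊆ B := fun b hb => hS (hS₀ hb)
  have hQ0 := hB.prod_pos hS₀B
  have hQdvd : ∀ b ∈ S₀, (b : ℤ) ∣ ((∏ c ∈ S₀, c : ℕ) : ℤ) := fun b hb =>
    Int.natCast_dvd_natCast.mpr (Finset.dvd_prod_of_mem _ hb)
  have hprod : (∏ c ∈ S \ S₀, c) * (∏ c ∈ S₀, c) = ∏ c ∈ S, c := Finset.prod_sdiff hS₀
  set Q := ∏ c ∈ S₀, c with hQ
  obtain ⟨L, rfl⟩ := hN
  set M := (∏ c ∈ S \ S₀, c) * L with hM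
  have hNM : (∏ c ∈ S, c) * L = Q * M := by rw [← hprod]; ring
  rw [hNM]
  have hQ' : (0 : ℤ) < Q := by exact_mod_cast hQ0
  set bad : ℕ → Finset ℕ := fun b =>
    (Finset.range M).filter (fun k : ℕ => (b : ℤ) ∣ t % Q + Q * k) with hbad
  set D := (S \ S₀).biUnion bad with hD
  have hDcard : (D.card : ℝ) ≤ M * (1 / 2) := by
    calc (D.card : ℝ) ≤ ∑ b ∈ S \ S₀, ((bad b).card : ℝ) := by
          exact_mod_cast Finset.card_biUnion_le
      _ = ∑ b ∈ S \ S₀, (M : ℝ) * (1 / b) := by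
          refine Finset.sum_congr rfl fun b hb => ?_
          have hbS := Finset.mem_sdiff.mp hb
          exact card_filter_dvd_add_mul_of_dvd (hB.pos (hS hbS.1))
            (hB.coprime_prod hS₀B (hS hbS.1) hbS.2) _
            ((Finset.dvd_prod_of_mem _ hb).mul_right _)
      _ = M * ∑ b ∈ S \ S₀, (1 : ℝ) / b := by rw [Finset.mul_sum]
      _ ≤ M * (1 / 2) := by gcongr
  have hinj : (Finset.range M \ D).card ≤ ((Finset.Ico (0 : ℤ) ((Q * M : ℕ) : ℤ)).filter
      (fun n => n ∈ sieved S ∧ (Q : ℤ) ∣ n - t)).card := by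
    refine Finset.card_le_card_of_injOn (fun k => t % Q + Q * k) ?_ ?_
    · intro k hk
      rw [Finset.mem_coe, Finset.mem_sdiff, Finset.mem_range] at hk
      rw [Finset.mem_coe, Finset.mem_filter, Finset.mem_Ico]
      have h0 := Int.emod_nonneg t hQ'.ne'
      have h1 := Int.emod_lt_of_pos t hQ'
      have hcls : (Q : ℤ) ∣ t % Q + Q * k - t := by
        have := Int.emod_add_mul_ediv t Q
        exact ⟨k - t / Q, by linear_combination this⟩
      refine ⟨⟨by positivity, ?_⟩, ?_, hcls⟩
      · have : (k : ℤ) + 1 ≤ M := by exact_mod_cast hk.1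
        push_cast
        nlinarith
      · intro b hb hd
        by_cases hb0 : b ∈ S₀
        · refine ht b hb0 ?_
          have := dvd_sub hd ((hQdvd b hb0).trans hcls)
          rwa [sub_sub_cancel] at this
        · exact hk.2 (Finset.mem_biUnion.mpr ⟨b, Finset.mem_sdiff.mpr ⟨hb, hb0⟩,
            Finset.mem_filter.mpr ⟨Finset.mem_range.mpr hk.1, hd⟩⟩)
    · intro k _ k' _ h
      have h1 : (Q : ℤ) * k = Q * k' := add_left_cancel h
      exact_mod_cast mul_left_cancel₀ hQ'.ne' h1
  have h1 : (M : ℝ) ≤ (Finset.range M \ D).card + D.card := by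
    have := Finset.le_card_sdiff D (Finset.range M)
    rw [Finset.card_range] at this
    exact_mod_cast Nat.sub_le_iff_le_add.mp this
  have h2 : (((Finset.range M \ D).card : ℕ) : ℝ) ≤ _ := Nat.cast_le.mpr hinj
  refine le_trans ?_ h2
  have hQr : (0 : ℝ) < Q := by exact_mod_cast hQ0
  rw [div_le_iff₀ (by positivity)]
  push_cast
  nlinarith

open Classical in
/-- Most of the sieved integers in an interval form an admissible set. -/
lemma IsErdos.exists_large_admissible (hB : IsErdos B) {S : Finset ℕ} {ε : ℝ}
    (hS : ∀ T : Finset ℕ, (T : Set ℕ) ⊆ B → Disjoint T S → ∑ b ∈ T, (1 : ℝ) / b < ε) (N : ℕ) :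
    ∃ A ⊆ (Finset.Ico (0 : ℤ) N).filter (· ∈ sieved S), IsBAdmissible B A ∧
      (((Finset.Ico (0 : ℤ) N).filter (· ∈ sieved S)).card : ℝ) - N * ε ≤ A.card := by
  set E := (Finset.Ico (0 : ℤ) N).filter (· ∈ sieved S) with hE
  set T := (Finset.range (N + 1)).filter (fun b => b ∈ B ∧ b ∉ S) with hT
  have hTB : ∀ b ∈ T, b ∈ B ∧ b ∉ S := fun b hb => (Finset.mem_filter.mp hb).2
  obtain ⟨A, hAE, hA, hAT⟩ := exists_subset_avoiding E T fun b hb => hB.pos (hTB b hb).1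
  refine ⟨A, hAE, fun b hb => ?_, ?_⟩
  · by_cases hbS : b ∈ S
    · refine ⟨0, fun a ha => ?_⟩
      rw [sub_zero]
      exact (Finset.mem_filter.mp (hAE ha)).2 b hbS
    · by_cases hbN : b ≤ N
      · exact hAT b (Finset.mem_filter.mpr ⟨Finset.mem_range.mpr (by omega), hb, hbS⟩)
      · refine ⟨N, fun a ha hd => ?_⟩
        have h1 := Finset.mem_Ico.mp (Finset.mem_filter.mp (hAE ha)).1
        have h2 := int_dvd_small hd (abs_lt.mpr ⟨by omega, by omega⟩)
        omega
  · have h1 := (hS T (fun b hb => (hTB b hb).1)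
      (Finset.disjoint_left.mpr fun b hb => (hTB b hb).2)).le
    have h2 : (E.card : ℝ) ≤ N := by
      have := Finset.card_filter_le (Finset.Ico (0 : ℤ) N) (· ∈ sieved S)
      rw [Int.card_Ico, sub_zero, Int.toNat_natCast] at this
      exact_mod_cast this
    have h3 : (E.card : ℝ) * ∑ b ∈ T, (1 : ℝ) / b ≤ N * ε := by gcongr
    linarith

variable {τ : (ℤ → Bool) → (ℤ → Bool)} {ℓ : ℕ}

/-- If single ones are erased, removing points isolated in a superset of the support does not change
the image. -/
lemma IsErdos.ca_remove_isolated (hB : IsErdos B) (hτ : IsCA (XB B) τ)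
    (hℓ : HasRadius (XB B) τ ℓ) (h0 : ∀ u, τ (ind {0}) u = false) {x : ℤ → Bool} (hx : x ∈ XB B)
    (I : Set ℤ) (hI : ∀ n ∈ I, ∀ j : ℤ, j ≠ 0 → |j| ≤ 2 * ℓ → x (n + j) = false) :
    τ x = τ (ind (supp x \ I)) := by
  have hz : ind (supp x \ I) ∈ XB B :=
    ind_mem_XB.mpr (IsBAdmissible.mono (A := supp x) hx Set.sdiff_subset)
  funext n
  by_cases hex : ∃ i ∈ I, n - ℓ ≤ i ∧ i ≤ n + ℓ ∧ x i = true
  · obtain ⟨i, hi, h1, h2, hxi⟩ := hex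
    have hw : ∀ k, n - ℓ ≤ k → k ≤ n + ℓ → k ≠ i → x k = false := by
      intro k h3 h4 hk
      have := hI i hi (k - i) (sub_ne_zero.mpr hk) (abs_le.mpr ⟨by omega, by omega⟩)
      rwa [add_sub_cancel] at this
    have e1 : τ x n = τ (ind {i}) n := by
      refine hℓ _ hx _ (ind_mem_XB.mpr (hB.admissible_singleton i)) n fun k h3 h4 => ?_
      rw [Bool.eq_iff_iff, ind_eq_true, Set.mem_singleton_iff]
      constructor
      · intro hk
        by_contra hne
        rw [hw k h3 h4 hne] at hk
        exact Bool.false_ne_true hk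
      · rintro rfl
        exact hxi
    have e2 : τ (ind (supp x \ I)) n = τ (ind ∅) n := by
      refine hℓ _ hz _ ind_empty_mem_XB n fun k h3 h4 => ind_eq_ind ?_
      refine iff_of_false ?_ (Set.notMem_empty _)
      rintro ⟨hk, hkI⟩
      by_cases hne : k = i
      · exact hkI (hne ▸ hi)
      · have hk' : x k = true := hk
        rw [hw k h3 h4 hne] at hk'
        exact Bool.false_ne_true hk'
    rw [e1, e2, hB.ca_zero hτ, hB.ca_singleton hτ, h0]
  · push Not at hex
    refine hℓ _ hx _ hz n fun k h3 h4 => ?_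
    rw [Bool.eq_iff_iff, ind_eq_true]
    exact ⟨fun hk => ⟨hk, fun hkI => hex k hkI h3 h4 hk⟩, fun hk => hk.1⟩

/-- A CA erasing single ones is not surjective. -/
lemma IsErdos.exists_ca_singleton_eq_true (hB : IsErdos B) (hτ : IsCA (XB B) τ)
    (hℓ : HasRadius (XB B) τ ℓ) (hsurj : Set.SurjOn τ (XB B) (XB B)) :
    ∃ u, τ (ind {0}) u = true := by
  classical
  by_contra! h0
  simp only [ne_eq, Bool.not_eq_true] at h0
  have hiso : ind {0} ∈ Xeta B := by
    rw [hB.Xeta_eq_XB]; exact ind_mem_XB.mpr (hB.admissible_singleton 0)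
  rw [Xeta, mem_closure_iff_agree] at hiso
  obtain ⟨_, ⟨t, rfl⟩, ht⟩ := hiso (Finset.Icc (-(2 * ℓ : ℤ)) (2 * ℓ))
  have htfree : ∀ b ∈ B, ¬ (b : ℤ) ∣ t := by
    have h1 := ht 0 (Finset.mem_Icc.mpr ⟨by omega, by omega⟩)
    rw [ind_eq_true.mpr (Set.mem_singleton 0), shiftPow, zero_add] at h1
    exact eta_eq_true.mp h1
  have htiso : ∀ j : ℤ, ∃ b : ℕ, j ≠ 0 → |j| ≤ 2 * ℓ → b ∈ B ∧ (b : ℤ) ∣ j + t := by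
    intro j
    by_cases hj : j ≠ 0 ∧ |j| ≤ 2 * ℓ
    · have h1 := ht j (Finset.mem_Icc.mpr (abs_le.mp hj.2))
      by_contra! hcon
      refine hj.1 (ind_eq_true.mp (h1.symm.trans (eta_eq_true.mpr fun b hb => ?_)))
      exact (hcon b).2.2 hb
    · exact ⟨0, fun h1 h2 => absurd ⟨h1, h2⟩ hj⟩
  choose g hg using htiso
  obtain ⟨S₀, hgS₀, hS₀B, hS₀⟩ := hB.exists_tail_lt_of_subset (ε := 1 / 2) (by norm_num)
    (((Finset.Icc (-(2 * ℓ : ℤ)) (2 * ℓ)).filter (· ≠ 0)).image g) (by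
      intro b hb
      obtain ⟨j, hj, rfl⟩ := Finset.mem_image.mp (Finset.mem_coe.mp hb)
      rw [Finset.mem_filter, Finset.mem_Icc] at hj
      exact (hg j hj.2 (abs_le.mpr hj.1)).1)
  have hQ0 := hB.prod_pos hS₀B
  have hQdvd : ∀ b ∈ S₀, (b : ℤ) ∣ ((∏ c ∈ S₀, c : ℕ) : ℤ) := fun b hb =>
    Int.natCast_dvd_natCast.mpr (Finset.dvd_prod_of_mem _ hb)
  have hcount := fun (S : Finset ℕ) (hS : (S : Set ℕ) ⊆ B) (hSS : S₀ ⊆ S) (N : ℕ) =>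
    hB.le_card_sieved_class hS hSS (hS₀ (S \ S₀)
      (fun b hb => hS (Finset.mem_sdiff.mp hb).1) Finset.sdiff_disjoint).le t
      (fun b hb => htfree b (hS₀B hb)) (N := N)
  set Q := ∏ c ∈ S₀, c with hQ
  have hQr : (0 : ℝ) < Q := by exact_mod_cast hQ0
  obtain ⟨S, hS₀S, hSB, hS⟩ := hB.exists_tail_lt_of_subset (ε := 1 / (4 * Q)) (by positivity)
    S₀ hS₀B
  have hP0 := hB.prod_pos hSB
  have hPdvd : ∀ b ∈ S, b ∣ ∏ c ∈ S, c := fun b hb => Finset.dvd_prod_of_mem _ hb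
  have hQP : Q ∣ ∏ c ∈ S, c := Finset.prod_dvd_prod_of_subset _ _ _ hS₀S
  have hcountS := hcount S hSB hS₀S
  set P := ∏ c ∈ S, c with hP
  set N := P * (4 * Q * (P + 2 * ℓ + 1)) with hN
  have hN0 : 0 < N := by positivity
  have hPN : P ∣ N := Dvd.intro _ rfl
  have hcountN := hcountS N hPN
  set I : Set ℤ := {n | n ∈ sieved S ∧ (Q : ℤ) ∣ n - t} with hI
  have hIiso : ∀ n ∈ I, ∀ j : ℤ, j ≠ 0 → |j| ≤ 2 * ℓ → n + j ∉ sieved S := by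
    intro n hn j hj hjl hmem
    have hgj : g j ∈ S₀ := hgS₀ (Finset.mem_image_of_mem _
      (Finset.mem_filter.mpr ⟨Finset.mem_Icc.mpr (abs_le.mp hjl), hj⟩))
    refine hmem (g j) (hS₀S hgj) ?_
    have h1 : n + j = (n - t) + (j + t) := by ring
    rw [h1]
    exact dvd_add ((hQdvd _ hgj).trans hn.2) (hg j hj hjl).2
  obtain ⟨A, hAsub, hAadm, hAcard⟩ := hB.exists_large_admissible hS N
  set H : Set ℤ := sieved S \ I with hH
  have hHper : ∀ n : ℤ, n % (N : ℤ) ∈ H ↔ n ∈ H := by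
    intro n
    have hdv : ∀ d : ℕ, d ∣ N → ∀ m : ℤ, ((d : ℤ) ∣ n % N - m ↔ (d : ℤ) ∣ n - m) := by
      intro d hd m
      have hd' : (d : ℤ) ∣ N := Int.natCast_dvd_natCast.mpr hd
      have h1 : (d : ℤ) ∣ n % N - n :=
        hd'.trans (Int.modEq_iff_dvd.mp (Int.mod_modEq n N).symm)
      have h2 : n % N - m = (n % N - n) + (n - m) := by ring
      rw [h2]
      exact dvd_add_right h1
    have hs : n % (N : ℤ) ∈ sieved S ↔ n ∈ sieved S := by
      refine forall₂_congr fun b hb => not_congr ?_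
      simpa using hdv b ((hPdvd b hb).trans hPN) 0
    simp only [hH, hI, Set.mem_sdiff, Set.mem_ofPred_eq]
    rw [hs, hdv Q (hQP.trans hPN)]
  set W : Finset ℤ := Finset.Ico (-(ℓ : ℤ)) (N + ℓ) with hW
  have hcover : A.powerset ⊆ (Finset.range P).biUnion fun r =>
      (W.filter (fun n => n - (r : ℤ) ∈ H)).powerset.image fun z : Finset ℤ =>
        (Finset.Ico (0 : ℤ) N).filter (fun n => τ (ind (z : Set ℤ)) n = true) := by
    intro Y hY
    rw [Finset.mem_powerset] at hY
    have hYadm : IsBAdmissible B (Y : Set ℤ) := hAadm.mono (Finset.coe_subset.mpr hY)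
    obtain ⟨x, hx, hxY⟩ := hsurj (ind_mem_XB.mpr hYadm)
    have hs : ∀ b : ℕ, ∃ s : ℤ, b ∈ B → ∀ a ∈ supp x, ¬ (b : ℤ) ∣ a - s := by
      intro b
      by_cases hb : b ∈ B
      · obtain ⟨s, hs⟩ := hx b hb
        exact ⟨s, fun _ => hs⟩
      · exact ⟨0, fun h => absurd h hb⟩
    choose s hs using hs
    obtain ⟨r₀, hr₀⟩ := exists_int_dvd_sub S (fun b hb => hB.pos (hSB hb))
      (fun a ha b hb => hB.coprime (hSB ha) (hSB hb)) s
    have hP' : (0 : ℤ) < P := by exact_mod_cast hP0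
    set r := (r₀ % P).toNat with hr
    have hr' : (r : ℤ) = r₀ % P := Int.toNat_of_nonneg (Int.emod_nonneg _ hP'.ne')
    have hrP : r < P := by
      have := Int.emod_lt_of_pos r₀ hP'
      omega
    have hxs : ∀ n, x n = true → n - (r : ℤ) ∈ sieved S := by
      intro n hn b hb hd
      refine hs b (hSB hb) n hn ?_
      have h1 : (b : ℤ) ∣ r - r₀ := by
        rw [hr']
        exact (Int.natCast_dvd_natCast.mpr (hPdvd b hb)).trans
          (Int.modEq_iff_dvd.mp (Int.mod_modEq r₀ P).symm)
      have h2 : n - s b = (n - r) + (r - r₀) + (r₀ - s b) := by ring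
      rw [h2]
      exact dvd_add (dvd_add hd h1) (hr₀ b hb)
    set J : Set ℤ := {n | n - (r : ℤ) ∈ I} with hJ
    have hrem := hB.ca_remove_isolated hτ hℓ h0 hx J (by
      intro n hn j hj hjl
      rw [Bool.eq_false_iff]
      intro hxn
      have h1 := hxs _ hxn
      rw [add_sub_right_comm] at h1
      exact hIiso _ hn j hj hjl h1)
    have hzadm : IsBAdmissible B (supp x \ J) :=
      IsBAdmissible.mono (A := supp x) hx Set.sdiff_subset
    have hzadm' : IsBAdmissible B ((W.filter (· ∈ supp x \ J) : Finset ℤ) : Set ℤ) :=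
      hzadm.mono fun n hn => (Finset.mem_filter.mp (Finset.mem_coe.mp hn)).2
    rw [Finset.mem_biUnion]
    refine ⟨r, Finset.mem_range.mpr hrP, Finset.mem_image.mpr
      ⟨W.filter (· ∈ supp x \ J), Finset.mem_powerset.mpr ?_, ?_⟩⟩
    · intro n hn
      rw [Finset.mem_filter] at hn ⊢
      exact ⟨hn.1, hxs n hn.2.1, hn.2.2⟩
    · ext n
      rw [Finset.mem_filter]
      have hval : 0 ≤ n → n < N →
          (τ (ind ((W.filter (· ∈ supp x \ J) : Finset ℤ) : Set ℤ)) n = true ↔ n ∈ Y) := by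
        intro hn1 hn2
        rw [← Finset.mem_coe, ← ind_eq_true, ← hxY, hrem]
        refine iff_of_eq (congrArg (· = true) ?_)
        refine hℓ _ (ind_mem_XB.mpr hzadm') _ (ind_mem_XB.mpr hzadm) n fun i h1 h2 => ind_eq_ind ?_
        rw [Finset.mem_coe, Finset.mem_filter, hW, Finset.mem_Ico]
        exact ⟨fun h => h.2, fun h => ⟨⟨by omega, by omega⟩, h⟩⟩
      rw [Finset.mem_Ico]
      constructor
      · rintro ⟨⟨hn1, hn2⟩, hn⟩
        exact (hval hn1 hn2).mp hn
      · intro hn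
        have h1 := Finset.mem_Ico.mp (Finset.mem_filter.mp (hAsub (hY hn))).1
        exact ⟨h1, (hval h1.1 h1.2).mpr hn⟩
  set cH := ((Finset.Ico (0 : ℤ) N).filter (· ∈ H)).card with hcH
  have hpow : 2 ^ A.card ≤ P * 2 ^ (cH + 2 * ℓ) := by
    rw [← Finset.card_powerset]
    refine (Finset.card_le_card hcover).trans ?_
    refine (Finset.card_biUnion_le_card_mul _ _ (2 ^ (cH + 2 * ℓ)) fun r _ => ?_).trans_eq
      (by rw [Finset.card_range])
    refine Finset.card_image_le.trans ?_
    rw [Finset.card_powerset]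
    refine Nat.pow_le_pow_right two_pos ?_
    convert card_filter_shift_le H N hN0 hHper r ℓ
  have hle : A.card ≤ P + (cH + 2 * ℓ) := by
    refine (Nat.pow_le_pow_iff_right (a := 2) (by norm_num)).mp (hpow.trans ?_)
    rw [pow_add 2 P]
    exact Nat.mul_le_mul_right _ Nat.lt_two_pow_self.le
  have hsplit : cH + ((Finset.Ico (0 : ℤ) N).filter (· ∈ I)).card =
      ((Finset.Ico (0 : ℤ) N).filter (· ∈ sieved S)).card := by
    rw [hcH, ← Finset.card_union_of_disjoint, ← Finset.filter_or]
    · congr 1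
      refine Finset.filter_congr fun n _ => ?_
      constructor
      · rintro (h | h)
        · exact h.1
        · exact h.1
      · intro h
        by_cases hn : n ∈ I
        · exact Or.inr hn
        · exact Or.inl ⟨h, hn⟩
    · exact Finset.disjoint_filter.mpr fun n _ h => h.2
  have hsplit' : (cH : ℝ) + (((Finset.Ico (0 : ℤ) N).filter (· ∈ I)).card : ℝ) =
      (((Finset.Ico (0 : ℤ) N).filter (· ∈ sieved S)).card : ℝ) := by exact_mod_cast hsplit
  have hle' : (A.card : ℝ) ≤ P + (cH + 2 * ℓ) := by exact_mod_cast hle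
  have hcountN' : (N : ℝ) / (2 * Q) ≤ (((Finset.Ico (0 : ℤ) N).filter (· ∈ I)).card : ℝ) := by
    simpa only [hI, Set.mem_ofPred_eq] using hcountN
  have hNr : (N : ℝ) = P * (4 * Q * (P + 2 * ℓ + 1)) := by rw [hN]; push_cast; ring
  have e1 : (N : ℝ) / (2 * Q) = 2 * (P * (P + 2 * ℓ + 1)) := by rw [hNr]; field_simp; ring
  have e2 : (N : ℝ) * (1 / (4 * Q)) = P * (P + 2 * ℓ + 1) := by rw [hNr]; field_simp
  have hP1 : (1 : ℝ) ≤ P := by exact_mod_cast hP0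
  have hl0 : (0 : ℝ) ≤ ℓ := by positivity
  rw [e1] at hcountN'
  rw [e2] at hAcard
  nlinarith

end Counting

/-- On the `B`-free subshift of an Erdős set `B`, every surjective CA is a
power of the shift. -/
theorem surjective_ca_is_shift_power_erdos (B : Set ℕ) (hB : IsErdos B)
    (τ : (ℤ → Bool) → (ℤ → Bool)) (hτ : IsCA (Xeta B) τ)
    (hsurj : Set.SurjOn τ (Xeta B) (Xeta B)) :
    ∃ t : ℤ, Set.EqOn τ (shiftPow t) (Xeta B) := by
  have hη := fun t => shiftPow_eta_mem (B := B) t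
  have hcont : ∀ t, Continuous (shiftPow t) := fun t =>
    continuous_pi fun n => continuous_apply (n + t)
  have hclosed : IsClosed (Xeta B) := isClosed_closure
  rw [hB.Xeta_eq_XB] at hη hclosed hτ hsurj
  obtain ⟨ℓ, hℓ⟩ := hτ.exists_hasRadius hclosed
  obtain ⟨u, hu⟩ := hB.exists_ca_singleton_eq_true hτ hℓ hsurj
  have hη0 : eta B ∈ XB B := by simpa only [shiftPow_zero] using hη 0
  have hτη : τ (eta B) = shiftPow (-u) (eta B) := by
    obtain ⟨x, hx, hxη⟩ := hsurj (hη (-u))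
    have hxeq : x = eta B := hB.eq_eta_of_le hx fun n hn => by
      have h1 : τ x (n + u) = true := by simpa [hxη, shiftPow] using hn
      simpa using hB.ca_le_shiftPow hτ hℓ hu hx h1
    rw [← hxeq, hxη, hxeq]
  refine ⟨-u, ?_⟩
  have horbit : Set.EqOn τ (shiftPow (-u)) {x | ∃ t : ℤ, x = shiftPow t (eta B)} := by
    rintro _ ⟨t, rfl⟩
    rw [hτ.map_shiftPow hη0, hτη, shiftPow_shiftPow, shiftPow_shiftPow, add_comm]
  refine horbit.of_subset_closure ?_ (hcont _).continuousOn subset_closure subset_rfl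
  rw [hB.Xeta_eq_XB]
  exact hτ.2.1
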